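/- Let p ≥ 1 and let α, β be complex numbers with Re(α) > p-1 and Re(β) > p-1. Then ∫_{U > 0} det(U)^{α-p} det(I + U)^{-(α+β)} dμ_p(U) = Γ̃_p(α) Γ̃_p(β) / Γ̃_p(α+β), where the integral is over the cone of positive definite matrices in Herm(p) and the complex powers are of the positive real numbers det(U), det(I+U). -/

import Mathlib

open MeasureTheory Matrix
open scoped ComplexOrder

noncomputable section

/-- Parameter space `ℝ^p × ℂ^{p(p-1)/2}` for `p × p` Hermitian matrices:
the real diagonal entries together with the strictly upper-triangular complex entries. -/
abbrev HermParam (p : ℕ) : Type :=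
  (Fin p → ℝ) × ({ q : Fin p × Fin p // q.1 < q.2 } → ℂ)

/-- The linear isomorphism sending the parameters to the corresponding self-adjoint matrix. -/
def toHermMatrix (p : ℕ) (T : HermParam p) : Matrix (Fin p) (Fin p) ℂ :=
  Matrix.of fun i j =>
    if h : i < j then T.2 ⟨(i, j), h⟩
    else if h' : j < i then (starRingEnd ℂ) (T.2 ⟨(j, i), h'⟩)
    else (T.1 i : ℂ)

noncomputable instance matrixComplexMeasureSpace (m n : ℕ) :
    MeasureSpace (Matrix (Fin m) (Fin n) ℂ) :=
  inferInstanceAs (MeasureSpace (Fin m → Fin n → ℂ))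

/-- The Lebesgue measure `μ_p` on Herm(p), realized as a measure on the space of
`p × p` complex matrices: the pushforward of Lebesgue measure on the parameter space
under the linear isomorphism `toHermMatrix p`. -/
def hermLebesgue (p : ℕ) : Measure (Matrix (Fin p) (Fin p) ℂ) :=
  Measure.map (toHermMatrix p) volume

/-- The complex matrix-variate gamma function
`Γ̃_p(α) = π^{p(p-1)/2} ∏_{j=1}^p Γ(α - j + 1) = π^{p(p-1)/2} ∏_{j=0}^{p-1} Γ(α - j)`. -/
def cGammaP (p : ℕ) (α : ℂ) : ℂ :=
  (Real.pi : ℂ) ^ (p * (p - 1) / 2) * ∏ j : Fin p, Complex.Gamma (α - j)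

end

/-- `f` is integrable with respect to `μ`, with integral `v`. -/
def HasIntegralEq {X : Type*} [MeasurableSpace X] (f : X → ℂ) (μ : Measure X) (v : ℂ) : Prop :=
  Integrable f μ ∧ ∫ x, f x ∂μ = v

lemma HasIntegralEq.const_mul {X : Type*} [MeasurableSpace X] {f : X → ℂ} {μ : Measure X} {v : ℂ}
    (h : HasIntegralEq f μ v) (k : ℂ) : HasIntegralEq (fun x => k * f x) μ (k * v) :=
  ⟨h.1.const_mul k, by rw [integral_const_mul, h.2]⟩

/-- Fubini: the norm of `F` is again a family of the same kind, with slice integrals `g'`. -/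
lemma HasIntegralEq.prod {X Y : Type*} [MeasurableSpace X] [MeasurableSpace Y] {μ : Measure X}
    {ν : Measure Y} [SFinite μ] [SFinite ν] {F F' : X × Y → ℂ} {g g' : X → ℂ} {v : ℂ}
    (hF : Measurable F) (hslice : ∀ x, HasIntegralEq (fun y => F (x, y)) ν (g x))
    (hnorm : ∀ z, F' z = ‖F z‖) (hslice' : ∀ x, ∫ y, F' (x, y) ∂ν = g' x)
    (hg' : Integrable g' μ) (hg : ∫ x, g x ∂μ = v) : HasIntegralEq F (μ.prod ν) v := by
  have hint : Integrable F (μ.prod ν) := by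
    refine (integrable_prod_iff hF.aestronglyMeasurable).2
      ⟨Filter.Eventually.of_forall fun x => (hslice x).1, ?_⟩
    convert hg'.re using 2 with x
    rw [← hslice' x]
    simp_rw [hnorm]
    rw [integral_complex_ofReal]
    simp
  refine ⟨hint, ?_⟩
  rw [integral_prod _ hint, ← hg]
  exact integral_congr_ae (Filter.Eventually.of_forall fun x => (hslice x).2)

lemma image_mul_div_one_sub {s : ℝ} (hs : 0 < s) :
    (fun x : ℝ => s * x / (1 - x)) '' Set.Ioo 0 1 = Set.Ioi 0 := by
  ext t
  constructor
  · rintro ⟨x, ⟨h0, h1⟩, rfl⟩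
    exact div_pos (mul_pos hs h0) (by linarith)
  · intro (ht : 0 < t)
    refine ⟨t / (s + t), ⟨by positivity, (div_lt_one (by positivity)).2 (by linarith)⟩, ?_⟩
    have : s + t ≠ 0 := by positivity
    field_simp
    simp [hs.ne']

lemma hasIntegralEq_beta_Ioi {a b : ℂ} (ha : 0 < a.re) (hb : 0 < b.re) {s : ℝ} (hs : 0 < s) :
    HasIntegralEq (fun t : ℝ => (t : ℂ) ^ (a - 1) * ((s + t : ℝ) : ℂ) ^ (-(a + b)))
      (volume.restrict (Set.Ioi 0))
      ((s : ℂ) ^ (-b) * (Complex.Gamma a * Complex.Gamma b / Complex.Gamma (a + b))) := by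
  have hderiv : ∀ x ∈ Set.Ioo (0 : ℝ) 1,
      HasDerivWithinAt (fun x : ℝ => s * x / (1 - x)) (s / (1 - x) ^ 2) (Set.Ioo 0 1) x := by
    intro x hx
    have h1 : (1 - x) ≠ 0 := by linarith [hx.2]
    have := (((hasDerivAt_id x).const_mul s).div ((hasDerivAt_id x).const_sub 1) h1)
    refine (this.congr_deriv ?_).hasDerivWithinAt
    simp only [id]
    congr 1
    ring
  have hinj : Set.InjOn (fun x : ℝ => s * x / (1 - x)) (Set.Ioo 0 1) := by
    intro x hx y hy hxy
    have h1 : (1 - x) ≠ 0 := by linarith [hx.2]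
    have h2 : (1 - y) ≠ 0 := by linarith [hy.2]
    simp only at hxy
    field_simp at hxy
    linarith
  have hpt : ∀ x ∈ Set.Ioo (0 : ℝ) 1, |s / (1 - x) ^ 2| •
      (((s * x / (1 - x) : ℝ) : ℂ) ^ (a - 1) * ((s + s * x / (1 - x) : ℝ) : ℂ) ^ (-(a + b))) =
      (s : ℂ) ^ (-b) * ((x : ℂ) ^ (a - 1) * (1 - (x : ℂ)) ^ (b - 1)) := by
    intro x hx
    have h0 := hx.1
    have h1 : 0 < 1 - x := by linarith [hx.2]
    have e1 : s + s * x / (1 - x) = s * (1 - x)⁻¹ := by field_simp; ring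
    have e2 : s * x / (1 - x) = s * x * (1 - x)⁻¹ := rfl
    have hs' : (s : ℂ) ≠ 0 := by exact_mod_cast hs.ne'
    have h1' : ((1 - x : ℝ) : ℂ) ≠ 0 := by exact_mod_cast h1.ne'
    have h0' : (x : ℂ) ≠ 0 := by exact_mod_cast h0.ne'
    have einv : ∀ c : ℂ, (((1 - x : ℝ) : ℂ)⁻¹) ^ c = ((1 - x : ℝ) : ℂ) ^ (-c) := by
      intro c
      rw [Complex.inv_cpow, Complex.cpow_neg]
      rw [Complex.arg_ofReal_of_nonneg h1.le]
      exact Real.pi_pos.ne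
    rw [e1, e2, abs_of_pos (by positivity), Complex.real_smul]
    have hx1 : (1 : ℂ) - x = ((1 - x : ℝ) : ℂ) := by push_cast; rfl
    rw [hx1, Complex.ofReal_mul, Complex.ofReal_mul, Complex.ofReal_mul s,
      ← Complex.ofReal_mul s x, Complex.mul_cpow_ofReal_nonneg, Complex.mul_cpow_ofReal_nonneg,
      Complex.ofReal_mul, Complex.mul_cpow_ofReal_nonneg, Complex.ofReal_inv, einv, einv]
    rotate_left
    all_goals first | positivity | skip
    have hA : ((s / (1 - x) ^ 2 : ℝ) : ℂ) = (s : ℂ) ^ (1 : ℂ) * ((1 - x : ℝ) : ℂ) ^ (-2 : ℂ) := by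
      rw [Complex.cpow_neg, Complex.cpow_one, Complex.ofReal_div, Complex.ofReal_pow]
      norm_num [div_eq_mul_inv]
    rw [hA]
    have hS : (s : ℂ) ^ (-b) = s ^ (1 : ℂ) * s ^ (a - 1) * s ^ (-(a + b)) := by
      rw [← Complex.cpow_add _ _ hs', ← Complex.cpow_add _ _ hs']; ring_nf
    have hX : ((1 - x : ℝ) : ℂ) ^ (b - 1) = ((1 - x : ℝ) : ℂ) ^ (-2 : ℂ) *
        ((1 - x : ℝ) : ℂ) ^ (-(a - 1)) * ((1 - x : ℝ) : ℂ) ^ (-(-(a + b))) := by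
      rw [← Complex.cpow_add _ _ h1', ← Complex.cpow_add _ _ h1']; ring_nf
    rw [hS, hX]
    ring
  have hbeta := Complex.betaIntegral_convergent ha hb
  rw [intervalIntegrable_iff_integrableOn_Ioo_of_le zero_le_one] at hbeta
  have hval : Complex.Gamma a * Complex.Gamma b / Complex.Gamma (a + b) =
      Complex.betaIntegral a b := by
    rw [Complex.Gamma_mul_Gamma_eq_betaIntegral ha hb, mul_div_cancel_left₀]
    exact Complex.Gamma_ne_zero_of_re_pos (by simp; linarith)
  constructor
  · have := integrableOn_image_iff_integrableOn_abs_deriv_smul measurableSet_Ioo hderiv hinj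
      (fun t : ℝ => (t : ℂ) ^ (a - 1) * ((s + t : ℝ) : ℂ) ^ (-(a + b)))
    rw [image_mul_div_one_sub hs] at this
    refine this.2 ?_
    rw [integrableOn_congr_fun hpt measurableSet_Ioo]
    exact Integrable.const_mul hbeta _
  · have := integral_image_eq_integral_abs_deriv_smul measurableSet_Ioo hderiv hinj
      (fun t : ℝ => (t : ℂ) ^ (a - 1) * ((s + t : ℝ) : ℂ) ^ (-(a + b)))
    rw [image_mul_div_one_sub hs] at this
    rw [this, setIntegral_congr_fun measurableSet_Ioo hpt, integral_const_mul, hval,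
      Complex.betaIntegral, intervalIntegral.integral_of_le zero_le_one, integral_Ioc_eq_integral_Ioo]

lemma hasIntegralEq_complex {c : ℂ} (hc : 1 < c.re) {s : ℝ} (hs : 0 < s) :
    HasIntegralEq (fun w : ℂ => ((s + ‖w‖ ^ 2 : ℝ) : ℂ) ^ (-c)) volume
      (Real.pi * (s : ℂ) ^ (1 - c) * (Complex.Gamma (c - 1) / Complex.Gamma c)) := by
  obtain ⟨hI, hV⟩ := hasIntegralEq_beta_Ioi (a := 1) (b := c - 1) (by simp) (by simpa using hc) hs
  simp only [sub_self, Complex.cpow_zero, one_mul, add_sub_cancel, neg_sub,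
    Complex.Gamma_one] at hI hV
  have key := integrableOn_Ioi_comp_rpow_iff (fun t : ℝ => ((s + t : ℝ) : ℂ) ^ (-c))
    (p := 2) two_ne_zero
  have key2 := integral_comp_rpow_Ioi (fun t : ℝ => ((s + t : ℝ) : ℂ) ^ (-c))
    (p := 2) two_ne_zero
  have hpt : ∀ y : ℝ, (|(2:ℝ)| * y ^ ((2:ℝ) - 1)) • ((s + y ^ (2:ℝ) : ℝ) : ℂ) ^ (-c) =
      (2 : ℂ) * ((y ^ (Module.finrank ℝ ℂ - 1)) • ((s + y ^ 2 : ℝ) : ℂ) ^ (-c)) := by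
    intro y
    have : (2:ℝ) - 1 = 1 := by norm_num
    simp [Complex.finrank_real_complex, this]
    ring
  simp_rw [hpt] at key key2
  have hfin : IntegrableOn (fun y : ℝ => (y ^ (Module.finrank ℝ ℂ - 1)) •
      ((s + y ^ 2 : ℝ) : ℂ) ^ (-c)) (Set.Ioi 0) := by
    have h := (key.2 hI).const_mul (2⁻¹ : ℂ)
    simpa only [IntegrableOn, ← mul_assoc, inv_mul_cancel₀ (two_ne_zero (α := ℂ)), one_mul] using h
  refine ⟨(integrable_fun_norm_addHaar volume).2 hfin, ?_⟩
  rw [integral_fun_norm_addHaar volume (fun y : ℝ => ((s + y ^ 2 : ℝ) : ℂ) ^ (-c))]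
  rw [integral_const_mul, hV] at key2
  have hvol : (volume : Measure ℂ).real (Metric.ball 0 1) = Real.pi := by
    simp [Measure.real, Complex.volume_ball]
  rw [hvol, mul_assoc, ← key2, Complex.finrank_real_complex, Complex.real_smul, nsmul_eq_mul]
  push_cast
  ring

lemma norm_ofReal_cpow_eq {x : ℝ} (hx : 0 < x) (c : ℂ) :
    ((‖(x : ℂ) ^ c‖ : ℝ) : ℂ) = (x : ℂ) ^ (c.re : ℂ) := by
  rw [Complex.norm_cpow_eq_rpow_re_of_pos hx, Complex.ofReal_cpow hx.le]

lemma hasIntegralEq_pi_complex (n : ℕ) {c : ℂ} (hc : n < c.re) {s : ℝ} (hs : 0 < s) :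
    HasIntegralEq (fun w : Fin n → ℂ => ((s + ∑ i, ‖w i‖ ^ 2 : ℝ) : ℂ) ^ (-c)) volume
      (Real.pi ^ n * (s : ℂ) ^ (n - c) * (Complex.Gamma (c - n) / Complex.Gamma c)) := by
  induction n generalizing c s with
  | zero =>
    have hG : Complex.Gamma c ≠ 0 := Complex.Gamma_ne_zero_of_re_pos (by simpa using hc)
    constructor
    · simp
    · simp [hG, volume_pi, measureReal_def]
  | succ n ih =>
    have hmp := volume_preserving_piFinSuccAbove (fun _ : Fin (n + 1) => ℂ) 0
    have hpos : ∀ w : ℂ, 0 < s + ‖w‖ ^ 2 := fun w => by positivity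
    push_cast at hc
    have ihs : ∀ {c : ℂ}, n + 1 < c.re → ∀ x : ℂ,
        HasIntegralEq (fun w : Fin n → ℂ => ((s + ‖x‖ ^ 2 + ∑ i, ‖w i‖ ^ 2 : ℝ) : ℂ) ^ (-c)) volume
        (Real.pi ^ n * (Complex.Gamma (c - n) / Complex.Gamma c) *
          ((s + ‖x‖ ^ 2 : ℝ) : ℂ) ^ (-(c - n))) := by
      intro c hc x
      convert! ih (c := c) (by linarith) (hpos x) using 1
      rw [neg_sub]; ring
    have houter : ∀ {c : ℂ}, n + 1 < c.re → HasIntegralEq (fun x : ℂ =>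
        Real.pi ^ n * (Complex.Gamma (c - n) / Complex.Gamma c) *
          ((s + ‖x‖ ^ 2 : ℝ) : ℂ) ^ (-(c - n))) volume _ := fun {c} hc =>
      (hasIntegralEq_complex (c := c - n) (by simp; linarith) hs).const_mul _
    have hmeas : Measurable (fun z : ℂ × (Fin n → ℂ) =>
        ((s + ‖z.1‖ ^ 2 + ∑ i, ‖z.2 i‖ ^ 2 : ℝ) : ℂ) ^ (-c)) := by fun_prop
    have hnorm : ∀ z : ℂ × (Fin n → ℂ),
        ((s + ‖z.1‖ ^ 2 + ∑ i, ‖z.2 i‖ ^ 2 : ℝ) : ℂ) ^ (-(c.re : ℂ)) =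
          ‖((s + ‖z.1‖ ^ 2 + ∑ i, ‖z.2 i‖ ^ 2 : ℝ) : ℂ) ^ (-c)‖ := fun z => by
      rw [norm_ofReal_cpow_eq (by positivity)]; simp
    have hre : (n : ℝ) + 1 < (c.re : ℂ).re := by simpa using hc
    have hprod := HasIntegralEq.prod (μ := volume) (ν := volume) hmeas (ihs hc) hnorm
      (fun x => (ihs hre x).2) (houter hre).1 (houter hc).2
    have hcomp : (fun w : Fin (n + 1) → ℂ => ((s + ∑ i, ‖w i‖ ^ 2 : ℝ) : ℂ) ^ (-c)) =
        (fun z : ℂ × (Fin n → ℂ) => ((s + ‖z.1‖ ^ 2 + ∑ i, ‖z.2 i‖ ^ 2 : ℝ) : ℂ) ^ (-c)) ∘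
          (MeasurableEquiv.piFinSuccAbove (fun _ : Fin (n + 1) => ℂ) 0) := by
      ext w
      simp [Fin.sum_univ_succ, Fin.tail, add_assoc]
    rw [hcomp]
    refine ⟨(hmp.integrable_comp_emb (MeasurableEquiv.measurableEmbedding _)).2 hprod.1, ?_⟩
    refine (hmp.integral_comp' _).trans (hprod.2.trans ?_)
    have hG : Complex.Gamma (c - n) ≠ 0 :=
      Complex.Gamma_ne_zero_of_re_pos (by simp; linarith)
    have e1 : (1 - (c - n) : ℂ) = ((n + 1 : ℕ) : ℂ) - c := by push_cast; ring
    have e2 : (c - n - 1 : ℂ) = c - ((n + 1 : ℕ) : ℂ) := by push_cast; ring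
    rw [e1, e2, pow_succ]
    field_simp

lemma hasIntegralEq_quadratic {n : ℕ} {Q : Matrix (Fin n) (Fin n) ℂ} (hQ : Q.PosDef) {c : ℂ}
    (hc : n < c.re) :
    HasIntegralEq (fun z : Fin n → ℂ => ((1 + (star z ⬝ᵥ Q *ᵥ z).re : ℝ) : ℂ) ^ (-c)) volume
      ((Q.det.re : ℂ)⁻¹ * (Real.pi ^ n * (Complex.Gamma (c - n) / Complex.Gamma c))) := by
  obtain ⟨B, rfl⟩ := by
    open scoped MatrixOrder in
    exact CStarAlgebra.nonneg_iff_eq_star_mul_self.mp hQ.posSemidef.nonneg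
  rw [star_eq_conjTranspose] at *
  have hdet : B.det ≠ 0 := by
    have := hQ.isUnit
    rw [isUnit_iff_isUnit_det, det_mul] at this
    exact (isUnit_of_mul_isUnit_right this).ne_zero
  have hquad : ∀ z : Fin n → ℂ, (star z ⬝ᵥ (Bᴴ * B) *ᵥ z).re = ∑ i, ‖(B *ᵥ z) i‖ ^ 2 := by
    intro z
    rw [← mulVec_mulVec, dotProduct_mulVec, ← star_mulVec, dotProduct, Complex.re_sum]
    refine Finset.sum_congr rfl fun i _ => ?_
    simp [← Complex.normSq_eq_norm_sq, Complex.normSq_apply]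
  have hdetre : (Bᴴ * B).det.re = ‖B.det‖ ^ 2 := by
    rw [det_mul, det_conjTranspose]
    simp [← Complex.normSq_eq_norm_sq, Complex.normSq_apply]
  let f : (Fin n → ℂ) →ₗ[ℝ] (Fin n → ℂ) := (B.toLin').restrictScalars ℝ
  have hf : LinearMap.det f = ‖B.det‖ ^ 2 := by
    rw [LinearMap.det_restrictScalars, LinearMap.det_toLin', Algebra.norm_complex_apply,
      Complex.normSq_eq_norm_sq]
  have hf0 : LinearMap.det f ≠ 0 := by rw [hf]; positivity
  have hmap := Measure.map_linearMap_addHaar_eq_smul_addHaar (volume : Measure (Fin n → ℂ)) hf0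
  have hinj : Function.Injective f := by
    exact (LinearMap.equivOfDetNeZero f hf0).injective
  have hemb : MeasurableEmbedding f :=
    (f.continuous_of_finiteDimensional.measurable).measurableEmbedding hinj
  obtain ⟨hI, hV⟩ := hasIntegralEq_pi_complex n hc one_pos
  have hcomp : (fun z : Fin n → ℂ => ((1 + (star z ⬝ᵥ (Bᴴ * B) *ᵥ z).re : ℝ) : ℂ) ^ (-c)) =
      (fun w : Fin n → ℂ => ((1 + ∑ i, ‖w i‖ ^ 2 : ℝ) : ℂ) ^ (-c)) ∘ f := by
    ext z
    simp only [hquad, Function.comp]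
    rfl
  rw [hcomp]
  constructor
  · rw [← hemb.integrable_map_iff, hmap]
    exact hI.smul_measure ENNReal.ofReal_ne_top
  · have := hemb.integral_map (μ := volume)
      (fun w : Fin n → ℂ => ((1 + ∑ i, ‖w i‖ ^ 2 : ℝ) : ℂ) ^ (-c))
    refine this.symm.trans ?_
    rw [hmap, integral_smul_measure, hV, hf, hdetre, ENNReal.toReal_ofReal (by positivity),
      abs_of_nonneg (by positivity), Complex.real_smul]
    simp

lemma det_re_pos {n : ℕ} {V : Matrix (Fin n) (Fin n) ℂ} (hV : V.PosDef) : 0 < V.det.re :=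
  (Complex.pos_iff.1 hV.det_pos).1

lemma posDef_inv_sub_inv_one_add {n : ℕ} {V : Matrix (Fin n) (Fin n) ℂ} (hV : V.PosDef) :
    (V⁻¹ - (1 + V)⁻¹).PosDef ∧
      (V⁻¹ - (1 + V)⁻¹).det.re = (V.det.re)⁻¹ * ((1 + V).det.re)⁻¹ := by
  have hV1 : (1 + V).PosDef := PosDef.one.add hV
  have hu : IsUnit V.det := (isUnit_iff_isUnit_det _).1 hV.isUnit
  have hu1 : IsUnit (1 + V).det := (isUnit_iff_isUnit_det _).1 hV1.isUnit
  have heq : V⁻¹ - (1 + V)⁻¹ = ((1 + V) * V)⁻¹ := by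
    rw [Matrix.mul_inv_rev]
    calc V⁻¹ - (1 + V)⁻¹ = V⁻¹ * ((1 + V) * (1 + V)⁻¹) - V⁻¹ * V * (1 + V)⁻¹ := by
          rw [mul_nonsing_inv _ hu1, nonsing_inv_mul _ hu]; simp
      _ = _ := by noncomm_ring
  have hW : ((1 + V) * V).PosDef := by
    have : (1 + V) * V = V + Vᴴ * V := by rw [hV.1.eq]; noncomm_ring
    rw [this]
    exact hV.add_posSemidef (posSemidef_conjTranspose_mul_self V)
  rw [heq]
  refine ⟨hW.inv, ?_⟩
  have him := (Complex.pos_iff.1 hV.det_pos).2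
  have him1 := (Complex.pos_iff.1 hV1.det_pos).2
  have e : V.det = (V.det.re : ℂ) := Complex.ext rfl (by simp [← him])
  have e1 : (1 + V).det = ((1 + V).det.re : ℂ) := Complex.ext rfl (by simp [← him1])
  rw [det_nonsing_inv, det_mul, e, e1, Ring.inverse_eq_inv', ← Complex.ofReal_mul,
    ← Complex.ofReal_inv]
  simp [mul_comm]

/-- The bordered matrix with upper left block `V`, last column `z` and last diagonal entry `u`. -/
def bordered {n : ℕ} (V : Matrix (Fin n) (Fin n) ℂ) (z : Fin n → ℂ) (u : ℝ) :
    Matrix (Fin n ⊕ Fin 1) (Fin n ⊕ Fin 1) ℂ :=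
  fromBlocks V (replicateCol (Fin 1) z) (replicateCol (Fin 1) z)ᴴ (of fun _ _ => (u : ℂ))

lemma one_add_bordered {n : ℕ} (V : Matrix (Fin n) (Fin n) ℂ) (z : Fin n → ℂ) (u : ℝ) :
    1 + bordered V z u = bordered (1 + V) z (1 + u) := by
  rw [bordered, bordered, ← fromBlocks_one, fromBlocks_add]
  congr 1
  · simp
  · simp
  · ext i j
    fin_cases i; fin_cases j; simp

lemma Matrix.PosDef.ofReal_det_re {n : ℕ} {V : Matrix (Fin n) (Fin n) ℂ} (hV : V.PosDef) :
    ((V.det.re : ℝ) : ℂ) = V.det :=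
  Complex.ext rfl (by simp [← (Complex.pos_iff.1 hV.det_pos).2])

lemma Matrix.PosDef.ofReal_re_dotProduct {n : ℕ} {V : Matrix (Fin n) (Fin n) ℂ} (hV : V.PosDef)
    (z : Fin n → ℂ) : (((star z ⬝ᵥ V *ᵥ z).re : ℝ) : ℂ) = star z ⬝ᵥ V *ᵥ z :=
  Complex.ext rfl (by
    simp [← (Complex.nonneg_iff.1 (hV.posSemidef.dotProduct_mulVec_nonneg z)).2])

lemma schur_bordered {n : ℕ} {V : Matrix (Fin n) (Fin n) ℂ} (hV : V.PosDef) (z : Fin n → ℂ)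
    (u : ℝ) : (of fun _ _ => (u : ℂ)) - (replicateCol (Fin 1) z)ᴴ * V⁻¹ * replicateCol (Fin 1) z =
      (of fun _ _ => ((u - (star z ⬝ᵥ V⁻¹ *ᵥ z).re : ℝ) : ℂ)) := by
  ext i j
  rw [Matrix.sub_apply, of_apply, of_apply, Complex.ofReal_sub, hV.inv.ofReal_re_dotProduct,
    Matrix.mul_assoc]
  congr 1

lemma det_bordered {n : ℕ} {V : Matrix (Fin n) (Fin n) ℂ} (hV : V.PosDef) (z : Fin n → ℂ)
    (u : ℝ) : (bordered V z u).det =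
      ((V.det.re * (u - (star z ⬝ᵥ V⁻¹ *ᵥ z).re) : ℝ) : ℂ) := by
  have := hV.isUnit.invertible
  rw [bordered, det_fromBlocks₁₁, invOf_eq_nonsing_inv, schur_bordered hV, Complex.ofReal_mul,
    hV.ofReal_det_re]
  simp

lemma posDef_bordered_iff {n : ℕ} (V : Matrix (Fin n) (Fin n) ℂ) (z : Fin n → ℂ) (u : ℝ) :
    (bordered V z u).PosDef ↔ V.PosDef ∧ (star z ⬝ᵥ V⁻¹ *ᵥ z).re < u := by
  have key (hV : V.PosDef) : (bordered V z u).PosDef ↔ (star z ⬝ᵥ V⁻¹ *ᵥ z).re < u := by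
    have hinv := hV.isUnit.invertible
    have hd : 0 < V.det.re := (Complex.pos_iff.1 hV.det_pos).1
    have hsemi : (bordered V z u).PosSemidef ↔ (star z ⬝ᵥ V⁻¹ *ᵥ z).re ≤ u := by
      rw [bordered, PosDef.fromBlocks₁₁ _ _ hV, schur_bordered hV]
      have : (of fun _ _ : Fin 1 => ((u - (star z ⬝ᵥ V⁻¹ *ᵥ z).re : ℝ) : ℂ)) =
          diagonal fun _ => ((u - (star z ⬝ᵥ V⁻¹ *ᵥ z).re : ℝ) : ℂ) := by
        ext i j
        fin_cases i; fin_cases j; simp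
      rw [this, posSemidef_diagonal_iff]
      simp only [Complex.zero_le_real, forall_const, sub_nonneg]
    constructor
    · intro h
      have h1 := hsemi.1 h.posSemidef
      have h2 := h.posSemidef.posDef_iff_det_ne_zero.1 h
      rw [det_bordered hV] at h2
      refine lt_of_le_of_ne h1 fun h3 => h2 ?_
      simp [h3]
    · intro h
      have h1 := hsemi.2 h.le
      refine h1.posDef_iff_det_ne_zero.2 ?_
      rw [det_bordered hV, Complex.ofReal_ne_zero]
      exact (mul_pos hd (sub_pos.2 h)).ne'
  constructor
  · intro h
    have hV : V.PosDef := h.submatrix (e := Sum.inl) Sum.inl_injective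
    exact ⟨hV, (key hV).1 h⟩
  · rintro ⟨hV, h⟩
    exact (key hV).2 h

/-- The strictly upper-triangular positions of size `n + 1`: those of size `n`, and the last
column. -/
noncomputable def strictUpperSucc (n : ℕ) :
    { q : Fin n × Fin n // q.1 < q.2 } ⊕ Fin n ≃
      { q : Fin (n + 1) × Fin (n + 1) // q.1 < q.2 } :=
  Equiv.ofBijective
    (Sum.elim (fun q => ⟨(q.1.1.castSucc, q.1.2.castSucc), by simpa using q.2⟩)
      (fun i => ⟨(i.castSucc, Fin.last n), Fin.castSucc_lt_last i⟩))
    (by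
      constructor
      · rintro (⟨⟨a, b⟩, h⟩ | a) (⟨⟨c, d⟩, h'⟩ | c) h <;>
          simp_all [Fin.castSucc_ne_last, (Fin.castSucc_ne_last _).symm]
      · rintro ⟨⟨a, b⟩, h : a < b⟩
        obtain ⟨a, rfl⟩ := Fin.exists_castSucc_eq.2 (ne_of_lt (h.trans_le (Fin.le_last b)))
        rcases Fin.eq_castSucc_or_eq_last b with ⟨b, rfl⟩ | rfl
        · exact ⟨Sum.inl ⟨(a, b), by simpa using h⟩, rfl⟩
        · exact ⟨Sum.inr a, rfl⟩)

/-- Rearrangement of factors used to split off the last row and column. -/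
def prodShuffle (A B C R : Type*) [MeasurableSpace A] [MeasurableSpace B] [MeasurableSpace C]
    [MeasurableSpace R] : (R × A) × (B × C) ≃ᵐ (A × B) × (C × R) :=
  ((MeasurableEquiv.prodCongr MeasurableEquiv.prodComm (.refl _)).trans
    MeasurableEquiv.prodAssoc).trans
    ((MeasurableEquiv.prodCongr (.refl _)
      (MeasurableEquiv.prodComm.trans MeasurableEquiv.prodAssoc)).trans
        MeasurableEquiv.prodAssoc.symm)

lemma measurePreserving_prodShuffle (A B C R : Type*) [MeasureSpace A] [MeasureSpace B]
    [MeasureSpace C] [MeasureSpace R] [SigmaFinite (volume : Measure A)]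
    [SigmaFinite (volume : Measure B)] [SigmaFinite (volume : Measure C)]
    [SigmaFinite (volume : Measure R)] :
    MeasurePreserving (prodShuffle A B C R) volume volume :=
  ((volume_preserving_prodAssoc.comp
    ((Measure.measurePreserving_swap (μ := (volume : Measure R)) (ν := (volume : Measure A))).prod
      (MeasurePreserving.id (volume : Measure (B × C)))))).trans
    ((volume_preserving_prodAssoc (α₁ := A) (β₁ := B) (γ₁ := C × R)).symm.comp
      ((MeasurePreserving.id (volume : Measure A)).prod
        (volume_preserving_prodAssoc.comp (Measure.measurePreserving_swap
          (μ := (volume : Measure R)) (ν := (volume : Measure (B × C)))))))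

/-- Splitting off the last row and column of the parameters. -/
noncomputable def hermParamSucc (n : ℕ) : HermParam (n + 1) ≃ᵐ HermParam n × ((Fin n → ℂ) × ℝ) :=
  (MeasurableEquiv.prodCongr (MeasurableEquiv.piFinSuccAbove (fun _ => ℝ) (Fin.last n))
    ((MeasurableEquiv.piCongrLeft (fun _ => ℂ) (strictUpperSucc n)).symm.trans
      (MeasurableEquiv.sumPiEquivProdPi fun _ => ℂ))).trans (prodShuffle _ _ _ _)

lemma measurePreserving_hermParamSucc (n : ℕ) :
    MeasurePreserving (hermParamSucc n) volume volume :=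
  (measurePreserving_prodShuffle _ _ _ _).comp
    ((volume_preserving_piFinSuccAbove (fun _ => ℝ) (Fin.last n)).prod
      ((volume_measurePreserving_sumPiEquivProdPi fun _ => ℂ).comp
        (volume_measurePreserving_piCongrLeft (fun _ => ℂ) (strictUpperSucc n)).symm))

lemma hermParamSucc_apply (n : ℕ) (T : HermParam (n + 1)) :
    hermParamSucc n T = ((fun i => T.1 i.castSucc, fun q => T.2 (strictUpperSucc n (.inl q))),
      (fun i => T.2 (strictUpperSucc n (.inr i)), T.1 (Fin.last n))) := by
  refine Prod.ext (Prod.ext ?_ rfl) rfl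
  ext i
  change T.1 ((Fin.last n).succAbove i) = _
  simp

lemma toHermMatrix_succ (n : ℕ) (T : HermParam (n + 1)) :
    (toHermMatrix (n + 1) T).submatrix finSumFinEquiv finSumFinEquiv =
      bordered (toHermMatrix n (hermParamSucc n T).1) (hermParamSucc n T).2.1
        (hermParamSucc n T).2.2 := by
  rw [hermParamSucc_apply]
  ext i j
  have hl : ∀ i : Fin n, finSumFinEquiv (Sum.inl i : Fin n ⊕ Fin 1) = i.castSucc := fun i => rfl
  have hr : ∀ i : Fin 1, finSumFinEquiv (Sum.inr i : Fin n ⊕ Fin 1) = Fin.last n := fun i => by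
    fin_cases i; rfl
  rcases i with i | i <;> rcases j with j | j
  · simp only [submatrix_apply, hl, bordered, fromBlocks_apply₁₁, toHermMatrix, of_apply,
      Fin.castSucc_lt_castSucc_iff]
    rfl
  · simp only [submatrix_apply, hl, hr, bordered, fromBlocks_apply₁₂, toHermMatrix, of_apply,
      Fin.castSucc_lt_last, dif_pos]
    rfl
  · simp only [submatrix_apply, hl, hr, bordered, fromBlocks_apply₂₁, toHermMatrix, of_apply,
      Fin.castSucc_lt_last, (Fin.castSucc_lt_last j).not_gt, dif_pos]
    rfl
  · simp [hr, bordered, toHermMatrix]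

lemma continuous_toHermMatrix (p : ℕ) : Continuous (toHermMatrix p) := by
  refine continuous_matrix fun i j => ?_
  simp only [toHermMatrix, of_apply]
  split_ifs <;> fun_prop

lemma measurableEmbedding_toHermMatrix (p : ℕ) : MeasurableEmbedding (toHermMatrix p) := by
  have : MeasurableSpace.CountablySeparated (Matrix (Fin p) (Fin p) ℂ) :=
    inferInstanceAs (MeasurableSpace.CountablySeparated (Fin p → Fin p → ℂ))
  refine Measurable.measurableEmbedding ?_ ?_
  · refine measurable_pi_iff.2 fun i => measurable_pi_iff.2 fun j => ?_
    exact ((continuous_toHermMatrix p).matrix_elem i j).measurable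
  · intro S T h
    have hij : ∀ i j, toHermMatrix p S i j = toHermMatrix p T i j := fun i j => by rw [h]
    refine Prod.ext (funext fun i => ?_) (funext fun ⟨⟨i, j⟩, (hlt : i < j)⟩ => ?_)
    · simpa [toHermMatrix] using hij i i
    · simpa [toHermMatrix, hlt] using hij i j

lemma measurableSet_posDef_toHermMatrix (p : ℕ) :
    MeasurableSet {T : HermParam p | (toHermMatrix p T).PosDef} := by
  have hc := continuous_toHermMatrix p
  have heq : {T : HermParam p | (toHermMatrix p T).PosDef} =
      {T | (toHermMatrix p T).PosSemidef} ∩ {T | (toHermMatrix p T).det ≠ 0} := by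
    ext T
    exact ⟨fun h => ⟨h.posSemidef, h.posSemidef.posDef_iff_det_ne_zero.1 h⟩,
      fun h => h.1.posDef_iff_det_ne_zero.2 h.2⟩
  rw [heq]
  refine MeasurableSet.inter (IsClosed.measurableSet ?_)
    (isOpen_ne_fun hc.matrix_det continuous_const).measurableSet
  simp only [posSemidef_iff_dotProduct_mulVec, Set.ofPred_and, Set.ofPred_forall]
  refine IsClosed.inter (isClosed_eq hc.matrix_conjTranspose hc) (isClosed_iInter fun x => ?_)
  exact isClosed_le continuous_const
    (continuous_const.dotProduct (hc.matrix_mulVec continuous_const))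

open Classical in
/-- The integrand of the matrix-variate beta integral, as a function of the parameters. -/
noncomputable def betaKernel (p : ℕ) (α β : ℂ) (T : HermParam p) : ℂ :=
  if (toHermMatrix p T).PosDef then
    ((toHermMatrix p T).det.re : ℂ) ^ (α - p) * ((1 + toHermMatrix p T).det.re : ℂ) ^ (-(α + β))
  else 0

lemma measurable_betaKernel (p : ℕ) (α β : ℂ) : Measurable (betaKernel p α β) := by
  have hc := continuous_toHermMatrix p
  have h1 : Measurable fun T => ((toHermMatrix p T).det.re : ℂ) :=
    (Complex.continuous_ofReal.comp (Complex.continuous_re.comp hc.matrix_det)).measurable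
  have h2 : Measurable fun T => ((1 + toHermMatrix p T).det.re : ℂ) :=
    (Complex.continuous_ofReal.comp (Complex.continuous_re.comp
      (continuous_const.add hc).matrix_det)).measurable
  exact Measurable.ite (measurableSet_posDef_toHermMatrix p)
    ((h1.pow_const _).mul (h2.pow_const _)) measurable_const

lemma ofReal_norm_betaKernel (p : ℕ) (α β : ℂ) (T : HermParam p) :
    betaKernel p α.re β.re T = ‖betaKernel p α β T‖ := by
  unfold betaKernel
  split_ifs with h
  · rw [norm_mul, Complex.ofReal_mul, norm_ofReal_cpow_eq (det_re_pos h),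
      norm_ofReal_cpow_eq (det_re_pos (PosDef.one.add h))]
    simp
  · simp

open Classical in
lemma betaKernel_hermParamSucc_symm (n : ℕ) (α β : ℂ) (T : HermParam n) (z : Fin n → ℂ) (u : ℝ) :
    betaKernel (n + 1) α β ((hermParamSucc n).symm (T, z, u)) =
      if (toHermMatrix n T).PosDef ∧ (star z ⬝ᵥ (toHermMatrix n T)⁻¹ *ᵥ z).re < u then
        (((toHermMatrix n T).det.re * (u - (star z ⬝ᵥ (toHermMatrix n T)⁻¹ *ᵥ z).re) : ℝ) : ℂ) ^
            (α - (n + 1 : ℕ)) *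
          (((1 + toHermMatrix n T).det.re *
            (1 + u - (star z ⬝ᵥ (1 + toHermMatrix n T)⁻¹ *ᵥ z).re) : ℝ) : ℂ) ^ (-(α + β))
      else 0 := by
  have h := toHermMatrix_succ n ((hermParamSucc n).symm (T, z, u))
  rw [MeasurableEquiv.apply_symm_apply] at h
  set U := toHermMatrix (n + 1) ((hermParamSucc n).symm (T, z, u)) with hU
  have hpd : U.PosDef ↔
      (toHermMatrix n T).PosDef ∧ (star z ⬝ᵥ (toHermMatrix n T)⁻¹ *ᵥ z).re < u := by
    rw [← posDef_bordered_iff, ← h]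
    refine ⟨fun hU => hU.submatrix finSumFinEquiv.injective, fun hU => ?_⟩
    simpa using hU.submatrix (finSumFinEquiv (m := n) (n := 1)).symm.injective
  have h1 : (1 + U).submatrix finSumFinEquiv finSumFinEquiv =
      bordered (1 + toHermMatrix n T) z (1 + u) := by
    rw [← one_add_bordered, ← h, submatrix_add, Pi.add_apply, Pi.add_apply, submatrix_one_equiv]
  unfold betaKernel
  rw [← hU]
  by_cases hp : U.PosDef
  · rw [if_pos hp, if_pos (hpd.1 hp), ← det_submatrix_equiv_self finSumFinEquiv U, h,
      det_bordered (hpd.1 hp).1, ← det_submatrix_equiv_self finSumFinEquiv (1 + U), h1,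
      det_bordered (PosDef.one.add (hpd.1 hp).1), Complex.ofReal_re, Complex.ofReal_re]
  · rw [if_neg hp, if_neg (fun hh => hp (hpd.2 hh))]

lemma hasIntegralEq_zero {X : Type*} [MeasurableSpace X] (μ : Measure X) :
    HasIntegralEq (fun _ : X => (0 : ℂ)) μ 0 :=
  ⟨integrable_zero _ _ _, by simp⟩

/-- The translated half-line beta integral. -/
lemma hasIntegralEq_beta_translate {a b : ℂ} (ha : 0 < a.re) (hb : 0 < b.re) {q r : ℝ}
    (hqr : 0 < 1 + (q - r)) :
    HasIntegralEq (fun u : ℝ => (Set.Ioi q).indicator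
        (fun u => ((u - q : ℝ) : ℂ) ^ (a - 1) * ((1 + u - r : ℝ) : ℂ) ^ (-(a + b))) u) volume
      (((1 + (q - r) : ℝ) : ℂ) ^ (-b) *
        (Complex.Gamma a * Complex.Gamma b / Complex.Gamma (a + b))) := by
  obtain ⟨hI, hV⟩ := hasIntegralEq_beta_Ioi ha hb hqr
  set g : ℝ → ℂ := (Set.Ioi 0).indicator fun t : ℝ => (t : ℂ) ^ (a - 1) *
    ((1 + (q - r) + t : ℝ) : ℂ) ^ (-(a + b)) with hg
  have heq : (fun u : ℝ => (Set.Ioi q).indicator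
      (fun u => ((u - q : ℝ) : ℂ) ^ (a - 1) * ((1 + u - r : ℝ) : ℂ) ^ (-(a + b))) u) =
      fun u => g (u - q) := by
    ext u
    simp only [hg, Set.indicator_apply, Set.mem_Ioi, sub_pos]
    congr 5
    ring
  have hgI : Integrable g := (integrable_indicator_iff measurableSet_Ioi).2 hI
  rw [heq]
  refine ⟨hgI.comp_sub_right q, ?_⟩
  rw [integral_sub_right_eq_self g q, hg, integral_indicator measurableSet_Ioi, hV]

lemma betaKernel_slice {n : ℕ} {α β : ℂ} (hα : n < α.re) (hβ : n < β.re) {T : HermParam n}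
    (hT : (toHermMatrix n T).PosDef) (z : Fin n → ℂ) :
    HasIntegralEq (fun u => betaKernel (n + 1) α β ((hermParamSucc n).symm (T, z, u))) volume
      (((toHermMatrix n T).det.re : ℂ) ^ (α - (n + 1 : ℕ)) *
          ((1 + toHermMatrix n T).det.re : ℂ) ^ (-(α + β)) *
          (Complex.Gamma (α - n) * Complex.Gamma (β + n) / Complex.Gamma (α + β)) *
        ((1 + (star z ⬝ᵥ ((toHermMatrix n T)⁻¹ - (1 + toHermMatrix n T)⁻¹) *ᵥ z).re : ℝ) : ℂ) ^
          (-(β + n))) := by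
  set V := toHermMatrix n T with hV
  have hV1 : (1 + V).PosDef := PosDef.one.add hT
  have hQ := (posDef_inv_sub_inv_one_add hT).1
  have hsub : (star z ⬝ᵥ (V⁻¹ - (1 + V)⁻¹) *ᵥ z).re =
      (star z ⬝ᵥ V⁻¹ *ᵥ z).re - (star z ⬝ᵥ (1 + V)⁻¹ *ᵥ z).re := by
    rw [sub_mulVec, dotProduct_sub, Complex.sub_re]
  have hnonneg : 0 ≤ (star z ⬝ᵥ (V⁻¹ - (1 + V)⁻¹) *ᵥ z).re :=
    (Complex.nonneg_iff.1 (hQ.posSemidef.dotProduct_mulVec_nonneg z)).1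
  rw [hsub] at hnonneg ⊢
  have hn : (0 : ℝ) ≤ n := n.cast_nonneg
  have h := (hasIntegralEq_beta_translate (a := α - n) (b := β + n)
    (by simpa using hα) (by simp; linarith) (q := (star z ⬝ᵥ V⁻¹ *ᵥ z).re)
    (r := (star z ⬝ᵥ (1 + V)⁻¹ *ᵥ z).re) (by linarith)).const_mul
    ((V.det.re : ℂ) ^ (α - (n + 1 : ℕ)) * ((1 + V).det.re : ℂ) ^ (-(α + β)))
  convert! h using 1
  · ext u
    rw [betaKernel_hermParamSucc_symm, ← hV, Set.indicator_apply]
    by_cases hu : (star z ⬝ᵥ V⁻¹ *ᵥ z).re < u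
    · rw [if_pos ⟨hT, hu⟩, if_pos (Set.mem_Ioi.2 hu), Complex.ofReal_mul, Complex.ofReal_mul,
        Complex.mul_cpow_ofReal_nonneg (det_re_pos hT).le (by linarith),
        Complex.mul_cpow_ofReal_nonneg (det_re_pos hV1).le (by linarith)]
      have e1 : α - n - 1 = α - (n + 1 : ℕ) := by push_cast; ring
      have e2 : α - n + (β + n) = α + β := by ring
      rw [e1, e2]
      ring
    · rw [if_neg (fun hh => hu hh.2), if_neg (by simpa using hu), mul_zero]
  · have e2 : α - n + (β + n) = α + β := by ring
    rw [e2]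
    ring

lemma betaKernel_not_posDef {n : ℕ} (α β : ℂ) {T : HermParam n}
    (hT : ¬ (toHermMatrix n T).PosDef) (z : Fin n → ℂ) (u : ℝ) :
    betaKernel (n + 1) α β ((hermParamSucc n).symm (T, z, u)) = 0 := by
  rw [betaKernel_hermParamSucc_symm, if_neg fun h => hT h.1]

lemma betaKernel_border {n : ℕ} {α β : ℂ} (hα : n < α.re) (hβ : n < β.re) (T : HermParam n) :
    HasIntegralEq (fun y => betaKernel (n + 1) α β ((hermParamSucc n).symm (T, y))) volume
      (Real.pi ^ n * (Complex.Gamma (α - n) * Complex.Gamma β / Complex.Gamma (α + β)) *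
        betaKernel n α (β - 1) T) := by
  by_cases hT : (toHermMatrix n T).PosDef
  swap
  · have h0 : (fun y => betaKernel (n + 1) α β ((hermParamSucc n).symm (T, y))) = fun _ => 0 :=
      funext fun y => betaKernel_not_posDef α β hT y.1 y.2
    rw [h0, betaKernel, if_neg hT, mul_zero]
    exact hasIntegralEq_zero _
  have hn : (0 : ℝ) ≤ n := n.cast_nonneg
  have hslice := betaKernel_slice hα hβ hT
  have hslice' := betaKernel_slice (α := α.re) (β := β.re) (by simpa using hα) (by simpa using hβ) hT
  obtain ⟨hQ, hdet⟩ := posDef_inv_sub_inv_one_add hT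
  have hzint := fun (a b : ℂ) (hb : n < b.re) =>
    (hasIntegralEq_quadratic hQ (c := b + n) (by simp; linarith)).const_mul
      (((toHermMatrix n T).det.re : ℂ) ^ (a - (n + 1 : ℕ)) *
          ((1 + toHermMatrix n T).det.re : ℂ) ^ (-(a + b)) *
          (Complex.Gamma (a - n) * Complex.Gamma (b + n) / Complex.Gamma (a + b)))
  have h := HasIntegralEq.prod (μ := (volume : Measure (Fin n → ℂ))) (ν := (volume : Measure ℝ))
    (F := fun y => betaKernel (n + 1) α β ((hermParamSucc n).symm (T, y)))
    ((measurable_betaKernel _ α β).comp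
      ((hermParamSucc n).symm.measurable.comp measurable_prodMk_left))
    hslice (fun y => ofReal_norm_betaKernel _ α β _) (fun z => (hslice' z).2)
    (hzint α.re β.re (by simpa using hβ)).1 (hzint α β hβ).2
  convert! h using 1
  have hd : ((toHermMatrix n T).det.re : ℂ) ≠ 0 := by exact_mod_cast (det_re_pos hT).ne'
  have hd1 : ((1 + toHermMatrix n T).det.re : ℂ) ≠ 0 := by
    exact_mod_cast (det_re_pos (PosDef.one.add hT)).ne'
  have hG : Complex.Gamma (β + n) ≠ 0 := Complex.Gamma_ne_zero_of_re_pos (by simp; linarith)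
  have e1 : α - n = (α - (n + 1 : ℕ)) + 1 := by push_cast; ring
  have e2 : -(α + (β - 1)) = -(α + β) + 1 := by ring
  rw [betaKernel, if_pos hT, hdet, e2, Complex.cpow_add _ _ hd1, Complex.cpow_one,
    add_sub_cancel_right]
  have e3 : ((toHermMatrix n T).det.re : ℂ) ^ (α - n) =
      ((toHermMatrix n T).det.re : ℂ) ^ (α - (n + 1 : ℕ)) * (toHermMatrix n T).det.re := by
    rw [e1, Complex.cpow_add _ _ hd, Complex.cpow_one]
  rw [e3]
  push_cast
  field_simp

lemma cGammaP_succ_left (n : ℕ) (α : ℂ) :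
    cGammaP (n + 1) α = Real.pi ^ n * Complex.Gamma (α - n) * cGammaP n α := by
  have : (n + 1) * (n + 1 - 1) / 2 = n + n * (n - 1) / 2 := by
    rw [Nat.triangle_succ, add_comm]
  rw [cGammaP, cGammaP, this, pow_add, Fin.prod_univ_castSucc]
  simp only [Fin.val_castSucc, Fin.val_last]
  ring

lemma cGammaP_succ_right (n : ℕ) (α : ℂ) :
    cGammaP (n + 1) α = Real.pi ^ n * Complex.Gamma α * cGammaP n (α - 1) := by
  have : (n + 1) * (n + 1 - 1) / 2 = n + n * (n - 1) / 2 := by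
    rw [Nat.triangle_succ, add_comm]
  rw [cGammaP, cGammaP, this, pow_add, Fin.prod_univ_succ]
  have e : ∀ i : Fin n, α - (i.succ : ℕ) = α - 1 - (i : ℕ) := fun i => by
    rw [Fin.val_succ]; push_cast; ring
  simp only [e, Fin.val_zero, Nat.cast_zero, sub_zero]
  ring

lemma hasIntegralEq_betaKernel (p : ℕ) {α β : ℂ} (hα : (p - 1 : ℝ) < α.re)
    (hβ : (p - 1 : ℝ) < β.re) :
    HasIntegralEq (betaKernel p α β) volume (cGammaP p α * cGammaP p β / cGammaP p (α + β)) := by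
  induction p generalizing α β with
  | zero =>
    have h1 : betaKernel 0 α β = fun _ => 1 := by
      ext T
      have : (toHermMatrix 0 T).PosDef := by
        rw [Subsingleton.elim (toHermMatrix 0 T) 1]; exact PosDef.one
      rw [betaKernel, if_pos this]
      simp
    have h2 : (volume : Measure (HermParam 0)).real Set.univ = 1 := by
      rw [measureReal_def, Measure.volume_eq_prod, ← Set.univ_prod_univ, Measure.prod_prod]
      simp [volume_pi]
    have h3 : IsFiniteMeasure (volume : Measure (HermParam 0)) := ⟨by
      rw [Measure.volume_eq_prod, ← Set.univ_prod_univ, Measure.prod_prod]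
      simp [volume_pi]⟩
    rw [h1]
    refine ⟨integrable_const _, ?_⟩
    rw [integral_const, h2]
    simp [cGammaP]
  | succ n ih =>
    push_cast at hα hβ
    rw [add_sub_cancel_right] at hα hβ
    have hmp := (measurePreserving_hermParamSucc n).symm
    have hre : (n : ℝ) < (α.re : ℂ).re ∧ (n : ℝ) < (β.re : ℂ).re := by simpa using ⟨hα, hβ⟩
    have houter := fun {a b : ℂ} (ha : (n : ℝ) < a.re) (hb : (n : ℝ) < b.re) =>
      (ih (α := a) (β := b - 1) (by linarith) (by simpa using hb)).const_mul
        (Real.pi ^ n * (Complex.Gamma (a - n) * Complex.Gamma b / Complex.Gamma (a + b)))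
    have h := HasIntegralEq.prod (μ := (volume : Measure (HermParam n)))
      (ν := (volume : Measure ((Fin n → ℂ) × ℝ)))
      (F := fun y => betaKernel (n + 1) α β ((hermParamSucc n).symm y))
      ((measurable_betaKernel _ α β).comp (hermParamSucc n).symm.measurable)
      (betaKernel_border hα hβ) (fun y => ofReal_norm_betaKernel _ α β _)
      (fun T => (betaKernel_border hre.1 hre.2 T).2)
      (houter hre.1 hre.2).1 (houter hα hβ).2
    refine ⟨(hmp.integrable_comp_emb (MeasurableEquiv.measurableEmbedding _)).1 h.1, ?_⟩
    refine (hmp.integral_comp' _).symm.trans (h.2.trans ?_)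
    rw [cGammaP_succ_left n α, cGammaP_succ_right n β, cGammaP_succ_right n (α + β), add_sub_assoc]
    have hpi : (Real.pi : ℂ) ≠ 0 := by exact_mod_cast Real.pi_ne_zero
    field_simp

theorem stmt11 (p : ℕ) (hp : 1 ≤ p) (α β : ℂ)
    (hα : (p - 1 : ℝ) < α.re) (hβ : (p - 1 : ℝ) < β.re) :
    ∫ U in {U : Matrix (Fin p) (Fin p) ℂ | U.PosDef},
      ((U.det.re : ℂ) ^ (α - p) * (((1 + U).det.re : ℂ) ^ (-(α + β)))) ∂(hermLebesgue p)
    = cGammaP p α * cGammaP p β / cGammaP p (α + β) := by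
  rw [hermLebesgue, (measurableEmbedding_toHermMatrix p).setIntegral_map,
    ← (hasIntegralEq_betaKernel p hα hβ).2, Set.preimage_ofPred_eq,
    ← integral_indicator (measurableSet_posDef_toHermMatrix p)]
  refine integral_congr_ae (Filter.Eventually.of_forall fun T => ?_)
  by_cases h : (toHermMatrix p T).PosDef
  · exact (Set.indicator_of_mem (s := {T | (toHermMatrix p T).PosDef}) h _).trans (if_pos h).symm
  · exact (Set.indicator_of_notMem (s := {T | (toHermMatrix p T).PosDef}) h _).trans (if_neg h).symm
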